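/- arXiv:1801.05848 — 8 statements merged into one kernel-verified Lean document; each statement's English description precedes it below -/
import Mathlib

section
/- Let F ⊆ K be fields (K a field that is an F-algebra via an injective ring homomorphism φ : F → K). Fix integers m ≥ 2, ℓ ≥ 1, s ≥ 1, r_1,…,r_m ≥ 1; set k = mℓ − s, assume k ≥ ℓ, and set n = Σ_{i=1}^m (ℓ + r_i). Let G̃ ∈ K^{k×(mℓ)} satisfy the MRD criterion with respect to F: for every matrix E ∈ F^{k×(mℓ)} of rank k over F, the k×k matrix G̃ · φ(E)^T is invertible over K. For each i = 1,…,m let M_i ∈ F^{ℓ×(ℓ+r_i)} be a matrix in which every set of ℓ columns is linearly independent (i.e., M_i generates an [ℓ+r_i, ℓ]-MDS code over F), and let M = diag(M_1,…,M_m) ∈ F^{(mℓ)×n} be the block-diagonal matrix with the M_i on the diagonal. Then the matrix G = G̃ · φ(M) ∈ K^{k×n} satisfies the PMDS condition, i.e., its row space is an [n, k, ℓ; r_1,…,r_m]-PMDS code over K. -/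
/-- If every `ℓ` columns of `M` are linearly independent, then a vector with at most `ℓ` nonzero
entries in the kernel of `M` vanishes. -/
theorem eq_zero_of_mulVec_eq_zero_of_card_support_le {F : Type*} [Field F] {ℓ N : ℕ} (hN : ℓ ≤ N)
    (M : Matrix (Fin ℓ) (Fin N) F)
    (hM : ∀ e : Fin ℓ → Fin N, Function.Injective e →
      LinearIndependent F (fun t : Fin ℓ => (fun a : Fin ℓ => M a (e t))))
    (x : Fin N → F) (S : Finset (Fin N)) (hS : S.card ≤ ℓ) (hx : ∀ j, j ∉ S → x j = 0)
    (hMx : ∀ a, ∑ j, x j * M a j = 0) : x = 0 := by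
  obtain ⟨T, hST, -, hT⟩ :=
    Finset.exists_subsuperset_card_eq (Finset.subset_univ S) hS (by simpa using hN)
  have hli := Fintype.linearIndependent_iff.1 (hM _ (T.orderEmbOfFin hT).injective)
    (fun t => x (T.orderEmbOfFin hT t)) (by
      ext a
      simp only [Finset.sum_apply, Pi.smul_apply, smul_eq_mul, Pi.zero_apply]
      rw [← hMx a]
      have himg : Finset.univ.map (T.orderEmbOfFin hT).toEmbedding = T := by
        apply Finset.coe_injective
        simp
      calc _ = ∑ j ∈ Finset.univ.map (T.orderEmbOfFin hT).toEmbedding, x j * M a j := by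
            rw [Finset.sum_map]; rfl
        _ = ∑ j, x j * M a j := by
            rw [himg]
            refine Finset.sum_subset (Finset.subset_univ T) fun j _ hj => ?_
            rw [hx j fun h => hj (hST h), zero_mul])
  funext j
  by_cases hj : j ∈ S
  · have : j ∈ Set.range (T.orderEmbOfFin hT) := by
      rw [Finset.range_orderEmbOfFin]; exact hST hj
    obtain ⟨t, rfl⟩ := this
    exact hli t
  · exact hx j hj

/-- Distinct columns of a block-diagonal matrix whose blocks have every `ℓ` columns linearly
independent are linearly independent, if at most `ℓ` of them are taken from each block. -/
theorem linearIndependent_blockDiagonal_columns {F ι : Type*} [Field F] [Fintype ι]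
    {m ℓ : ℕ} (hℓ : 0 < ℓ) {r : Fin m → ℕ} (M : (i : Fin m) → Matrix (Fin ℓ) (Fin (ℓ + r i)) F)
    (hM : ∀ i, ∀ e : Fin ℓ → Fin (ℓ + r i), Function.Injective e →
      LinearIndependent F (fun t : Fin ℓ => (fun a : Fin ℓ => M i a (e t))))
    (e : ι → (i : Fin m) × Fin (ℓ + r i)) (he : Function.Injective e)
    (hcard : ∀ i : Fin m, (Finset.univ.filter (fun b => (e b).1 = i)).card ≤ ℓ) :
    LinearIndependent F (fun (b : ι) (q : Fin (m * ℓ)) =>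
      if q.1 / ℓ = (e b).1.1 then M (e b).1 ⟨q.1 % ℓ, Nat.mod_lt _ hℓ⟩ (e b).2 else 0) := by
  classical
  rw [Fintype.linearIndependent_iff]
  intro g hg b
  have hsum : ∀ f : ((i : Fin m) × Fin (ℓ + r i)) → F,
      ∑ c, Function.extend e g 0 c * f c = ∑ b, g b * f (e b) := by
    intro f
    refine (Fintype.sum_of_injective e he _ _ (fun c hc => ?_) fun b => ?_).symm
    · rw [Function.extend_apply' _ _ _ hc, Pi.zero_apply, zero_mul]
    · rw [he.extend_apply]
  have hzero : (fun j => Function.extend e g 0 ⟨(e b).1, j⟩) = 0 := by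
    refine eq_zero_of_mulVec_eq_zero_of_card_support_le (Nat.le_add_right _ _) (M (e b).1)
      (hM _) _ (Finset.univ.filter fun j => ∃ b', e b' = ⟨(e b).1, j⟩) ?_ ?_ fun a => ?_
    · refine le_trans ?_ (hcard (e b).1)
      rw [← Finset.card_map
          (Function.Embedding.sigmaMk (β := fun i : Fin m => Fin (ℓ + r i)) (e b).1),
        ← Finset.card_map (⟨e, he⟩ : ι ↪ _)]
      refine Finset.card_le_card fun c hc => ?_
      simp only [Finset.mem_map, Finset.mem_filter, Finset.mem_univ, true_and] at hc ⊢
      obtain ⟨j, ⟨b', hb'⟩, rfl⟩ := hc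
      exact ⟨b', by rw [hb'], hb'⟩
    · intro j hj
      simp only [Finset.mem_filter, Finset.mem_univ, true_and] at hj
      exact Function.extend_apply' _ _ _ hj
    · have hlt : ℓ * (e b).1.1 + a.1 < m * ℓ := by
        have h₁ := (e b).1.2
        have h₂ := a.2
        nlinarith
      have hdiv : (ℓ * (e b).1.1 + a.1) / ℓ = (e b).1.1 := by
        rw [Nat.mul_add_div hℓ, Nat.div_eq_of_lt a.2, add_zero]
      have hmod : (ℓ * (e b).1.1 + a.1) % ℓ = a.1 := by
        rw [Nat.mul_add_mod, Nat.mod_eq_of_lt a.2]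
      have h := congrFun hg ⟨ℓ * (e b).1.1 + a.1, hlt⟩
      simp only [Finset.sum_apply, Pi.smul_apply, smul_eq_mul, Pi.zero_apply, hdiv, hmod] at h
      rw [← hsum fun c => if (e b).1.1 = c.1.1 then M c.1 a c.2 else 0, Fintype.sum_sigma,
        Fintype.sum_eq_single (e b).1] at h
      · simpa using h
      · intro i hi
        have hne : (e b).1.1 ≠ i.1 := fun h => hi (Fin.ext h.symm)
        simp [hne]
  have := congrFun hzero (e b).2
  simpa [he.extend_apply] using this


/-- The PMDS condition on a generator matrix `G` whose columns are grouped into `m`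
blocks, block `i` having `ℓ + r i` columns: every `k × k` submatrix of `G` formed by
choosing `k` distinct columns, at most `ℓ` of them from each block, is invertible. -/
def PMDSCond (F : Type*) [Field F] {k m : ℕ} (ℓ : ℕ) (r : Fin m → ℕ)
    (G : Matrix (Fin k) ((i : Fin m) × Fin (ℓ + r i)) F) : Prop :=
  ∀ e : Fin k → (i : Fin m) × Fin (ℓ + r i), Function.Injective e →
    (∀ i : Fin m, (Finset.univ.filter (fun b => (e b).1 = i)).card ≤ ℓ) →
    IsUnit (Matrix.det (Matrix.of fun a b => G a (e b)))

/-- Let `φ : F → K` be an injective homomorphism of fields. If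
`G̃ ∈ K^{k×(mℓ)}` satisfies the MRD criterion with respect to `F` (for every matrix
`E ∈ F^{k×(mℓ)}` of rank `k`, `G̃ ⬝ φ(E)ᵀ` is invertible), and for each `i` the matrix
`M i ∈ F^{ℓ×(ℓ+r i)}` has every `ℓ` of its columns linearly independent, then
`G = G̃ ⬝ φ(M)`, where `M = diag(M_1, …, M_m)` is the block-diagonal matrix (row
`q : Fin (m*ℓ)` belongs to block `q / ℓ` and is row `q % ℓ` of that block), satisfies
the PMDS condition, i.e. generates an `[n, k, ℓ; r_1, …, r_m]`-PMDS code over `K`. -/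
theorem pmds_from_mrd_and_mds (F K : Type*) [Field F] [Field K]
    (φ : F →+* K) (hφ : Function.Injective φ)
    (m ℓ s k : ℕ) (r : Fin m → ℕ)
    (hm : 2 ≤ m) (hℓ : 1 ≤ ℓ) (hs : 1 ≤ s) (hr : ∀ i, 1 ≤ r i)
    (hk : k + s = m * ℓ) (hℓk : ℓ ≤ k)
    (Gt : Matrix (Fin k) (Fin (m * ℓ)) K)
    (hMRD : ∀ E : Matrix (Fin k) (Fin (m * ℓ)) F, E.rank = k →
      IsUnit ((Gt * (E.map φ).transpose).det))
    (M : (i : Fin m) → Matrix (Fin ℓ) (Fin (ℓ + r i)) F)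
    (hM : ∀ i, ∀ e : Fin ℓ → Fin (ℓ + r i), Function.Injective e →
      LinearIndependent F (fun t : Fin ℓ => (fun a : Fin ℓ => M i a (e t)))) :
    PMDSCond K ℓ r
      (Gt * (Matrix.of fun (q : Fin (m * ℓ)) (c : (i : Fin m) × Fin (ℓ + r i)) =>
        if q.1 / ℓ = c.1.1 then φ (M c.1 ⟨q.1 % ℓ, Nat.mod_lt _ (by omega)⟩ c.2) else 0)) := by
  intro e he hcard
  set E : Matrix (Fin k) (Fin (m * ℓ)) F := Matrix.of fun b q =>
    if q.1 / ℓ = (e b).1.1 then M (e b).1 ⟨q.1 % ℓ, Nat.mod_lt _ hℓ⟩ (e b).2 else 0 with hE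
  have hrank : E.rank = k := by
    have hli : LinearIndependent F E.row :=
      linearIndependent_blockDiagonal_columns hℓ M hM e he hcard
    simpa using hli.rank_matrix
  convert hMRD E hrank using 2
  ext a b
  simp [Matrix.mul_apply, hE, apply_ite φ]
end

section
/- Let m ≥ 2, ℓ ≥ 1, s ≥ 1 and r_1,…,r_m ≥ 1 be integers with k = mℓ − s ≥ ℓ, and set n = Σ_{i=1}^m (ℓ + r_i). Let p be a prime and let n_0 = min{ j ≥ 1 : p^j ≥ ℓ + r_i − 1 for all i = 1,…,m }. Then for every positive integer L that is a multiple of n_0 and satisfies L ≥ n_0·m·ℓ, there exists a matrix G ∈ F^{k×n} over the finite field F with p^L elements satisfying the PMDS condition, i.e., there exists an [n, k, ℓ; r_1,…,r_m]-PMDS code over the field with p^L elements. -/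
open Polynomial in
/-- A square Moore matrix over an extension of a finite field `F` is nonsingular when its
generators are linearly independent over `F`. -/
theorem Matrix.det_moore_ne_zero {F K : Type*} [Field F] [Fintype F] [Field K] [Algebra F K]
    {k : ℕ} {β : Fin k → K} (hβ : LinearIndependent F β) :
    (Matrix.of fun a b : Fin k => β b ^ Fintype.card F ^ (a : ℕ)).det ≠ 0 := by
  intro hdet
  obtain ⟨v, hv, hvM⟩ := Matrix.exists_vecMul_eq_zero_iff.mpr hdet
  have hq : 1 < Fintype.card F := Fintype.one_lt_card
  let φ : K →ₗ[F] K :=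
    ∑ a : Fin k, v a • (FiniteField.frobeniusAlgHom F K ^ (a : ℕ)).toLinearMap
  have hφ (x : K) : φ x = ∑ a : Fin k, v a * x ^ Fintype.card F ^ (a : ℕ) := by
    simp [φ, FiniteField.coe_frobeniusAlgHom, AlgHom.coe_pow, pow_iterate]
  have hφβ (b : Fin k) : φ (β b) = 0 := by
    rw [hφ]
    simpa [Matrix.vecMul, dotProduct] using congrFun hvM b
  let P : K[X] := ∑ a : Fin k, C (v a) * X ^ Fintype.card F ^ (a : ℕ)
  have hP : P = 0 := by
    refine eq_zero_of_natDegree_lt_card_of_eval_eq_zero P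
      (f := fun g : Fin k → F => ∑ b, g b • β b) ?_ ?_ ?_
    · exact fun g g' h => funext (Fintype.linearIndependent_iffₛ.mp hβ g g' h)
    · intro g
      have h : φ (∑ b, g b • β b) = 0 := by simp [map_sum, hφβ]
      rw [hφ] at h
      simpa [P, eval_finsetSum] using h
    · rw [Fintype.card_fun, Fintype.card_fin, Nat.lt_iff_le_pred (by positivity)]
      refine natDegree_sum_le_of_forall_le _ _ fun a _ => ?_
      exact (natDegree_C_mul_X_pow_le _ _).trans
        (Nat.le_pred_of_lt (Nat.pow_lt_pow_right hq a.isLt))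
  refine hv (funext fun a => ?_)
  have h := congrArg (coeff · (Fintype.card F ^ (a : ℕ))) hP
  simpa [P, finsetSum_coeff, coeff_C_mul, coeff_X_pow, Nat.pow_right_inj hq, Fin.val_inj]
    using h

/-- The columns of the generator matrix of the extended Reed–Solomon code of dimension `ℓ`,
indexed by the points of the projective line over `F`. -/
def extendedReedSolomon (F : Type*) [Field F] (ℓ : ℕ) (x : Option F) : Fin ℓ → F :=
  fun j => x.getD 1 ^ (j : ℕ) * (x.elim 0 fun _ => 1) ^ (j.rev : ℕ)

theorem linearIndependent_extendedReedSolomon {F : Type*} [Field F] {ℓ : ℕ}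
    {e : Fin ℓ → Option F} (he : Function.Injective e) :
    LinearIndependent F fun i => extendedReedSolomon F ℓ (e i) := by
  have hdet : (Matrix.projVandermonde (fun i => (e i).getD 1)
      (fun i => (e i).elim (0 : F) fun _ => 1)).det ≠ 0 := by
    rw [Matrix.det_projVandermonde]
    refine Finset.prod_ne_zero_iff.mpr fun i _ => Finset.prod_ne_zero_iff.mpr fun j hj => ?_
    have hij : e i ≠ e j := he.ne (Finset.mem_Ioi.mp hj).ne
    rcases hi : e i with _ | x <;> rcases hj : e j with _ | y <;> simp_all [sub_eq_zero, eq_comm]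
  exact Matrix.linearIndependent_rows_of_det_ne_zero hdet

theorem linearIndepOn_extendedReedSolomon {F : Type*} [Field F] [Fintype F] {ℓ : ℕ}
    (hℓ : ℓ ≤ Fintype.card F + 1) {T : Finset (Option F)} (hT : T.card ≤ ℓ) :
    LinearIndepOn F (extendedReedSolomon F ℓ) (T : Set (Option F)) := by
  obtain ⟨U, hTU, hU⟩ := Finset.exists_superset_card_eq hT (by simpa using hℓ)
  refine LinearIndepOn.mono ?_ (Finset.coe_subset.mpr hTU)
  have h := linearIndependent_extendedReedSolomon
    (Subtype.val_injective.comp (U.equivFinOfCardEq hU).symm.injective)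
  exact (linearIndependent_equiv (U.equivFinOfCardEq hU).symm).mp h

/-- Combining blockwise linearly independent coefficient vectors with one linearly independent
family yields a linearly independent family. -/
theorem LinearIndependent.sum_smul_of_linearIndepOn_fiber {F M ι κ τ : Type*} [Field F]
    [AddCommGroup M] [Module F M] [Fintype ι] [DecidableEq ι] [Fintype κ] [Fintype τ]
    {α : ι × κ → M} (hα : LinearIndependent F α) (f : τ → ι) (w : τ → κ → F)
    (hw : ∀ i, LinearIndepOn F w (Finset.univ.filter fun b => f b = i : Finset τ)) :
    LinearIndependent F fun b => ∑ j, w b j • α (f b, j) := by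
  rw [Fintype.linearIndependent_iff] at hα ⊢
  intro g hg
  have key := hα (fun x => ∑ b with f b = x.1, g b * w b x.2) ?_
  · intro b
    refine linearIndepOn_finset_iff.mp (hw (f b)) g ?_ b (by simp)
    ext j
    simpa using key (f b, j)
  · rw [← hg, Fintype.sum_prod_type]
    simp only [Finset.sum_smul, Finset.smul_sum, smul_smul]
    rw [← Finset.sum_fiberwise Finset.univ f]
    refine Finset.sum_congr rfl fun i _ => ?_
    rw [Finset.sum_comm]
    refine Finset.sum_congr rfl fun b hb => ?_
    rw [(Finset.mem_filter.mp hb).2]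

/-- A PMDS matrix over `K` exists as soon as `K` has degree at least `m * ℓ` over a finite
subfield carrying the local extended Reed–Solomon codes. -/
theorem exists_pmdsCond_of_finrank {F K : Type*} [Field F] [Fintype F] [Field K] [Algebra F K]
    {m ℓ k : ℕ} {r : Fin m → ℕ} (hℓ : ℓ ≤ Fintype.card F + 1)
    (hr : ∀ i, ℓ + r i ≤ Fintype.card F + 1) (hK : m * ℓ ≤ Module.finrank F K) :
    ∃ G : Matrix (Fin k) ((i : Fin m) × Fin (ℓ + r i)) K, PMDSCond K ℓ r G := by
  classical
  obtain ⟨α', hα'⟩ := exists_linearIndependent_of_le_finrank hK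
  let α : Fin m × Fin ℓ → K := α' ∘ finProdFinEquiv
  have hα : LinearIndependent F α := hα'.comp _ finProdFinEquiv.injective
  have hc (i : Fin m) : Nonempty (Fin (ℓ + r i) ↪ Option F) :=
    Function.Embedding.nonempty_of_card_le (by simpa using hr i)
  let c (i : Fin m) : Fin (ℓ + r i) ↪ Option F := (hc i).some
  let w (x : (i : Fin m) × Fin (ℓ + r i)) : Fin ℓ → F := extendedReedSolomon F ℓ (c x.1 x.2)
  refine ⟨Matrix.of fun a x =>
    (∑ j, w x j • α (x.1, j)) ^ Fintype.card F ^ (a : ℕ), fun e he hcard => ?_⟩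
  refine isUnit_iff_ne_zero.mpr (Matrix.det_moore_ne_zero
    (hα.sum_smul_of_linearIndepOn_fiber (fun b => (e b).1) (fun b => w (e b)) fun i => ?_))
  have hc_inj : ∀ x y : (i : Fin m) × Fin (ℓ + r i),
      x.1 = y.1 → c x.1 x.2 = c y.1 y.2 → x = y := by
    rintro ⟨i, x⟩ ⟨_, y⟩ rfl h
    exact congrArg (Sigma.mk i) ((c i).injective h)
  have hinj : Set.InjOn (fun b => c (e b).1 (e b).2)
      (Finset.univ.filter fun b => (e b).1 = i : Finset (Fin k)) := by
    intro b hb b' hb' h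
    rw [Finset.mem_coe, Finset.mem_filter] at hb hb'
    exact he (hc_inj _ _ (hb.2.trans hb'.2.symm) h)
  have hli := linearIndepOn_extendedReedSolomon hℓ (Finset.card_image_le.trans (hcard i) :
    ((Finset.univ.filter fun b => (e b).1 = i).image fun b => c (e b).1 (e b).2).card ≤ ℓ)
  rw [Finset.coe_image] at hli
  exact hli.comp_of_image hinj

/-- Let `p` be a prime and let
`n₀ = min { j ≥ 1 : p^j ≥ ℓ + r i − 1 for all i }`. Then for every positive integer `L`
that is a multiple of `n₀` and satisfies `L ≥ n₀ · m · ℓ`, there exists an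
`[n, k, ℓ; r_1, …, r_m]`-PMDS code over the field with `p^L` elements. -/
theorem pmds_exists_galoisField (p : ℕ) [Fact p.Prime]
    (m ℓ s k : ℕ) (r : Fin m → ℕ)
    (hm : 2 ≤ m) (hℓ : 1 ≤ ℓ) (hs : 1 ≤ s) (hr : ∀ i, 1 ≤ r i)
    (hk : k + s = m * ℓ) (hℓk : ℓ ≤ k)
    (n₀ : ℕ) (hn₀pos : 1 ≤ n₀) (hn₀ : ∀ i, ℓ + r i - 1 ≤ p ^ n₀)
    (hn₀min : ∀ j, 1 ≤ j → (∀ i, ℓ + r i - 1 ≤ p ^ j) → n₀ ≤ j)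
    (L : ℕ) (hLpos : 1 ≤ L) (hdvd : n₀ ∣ L) (hL : n₀ * m * ℓ ≤ L) :
    ∃ G : Matrix (Fin k) ((i : Fin m) × Fin (ℓ + r i)) (GaloisField p L),
      PMDSCond (GaloisField p L) ℓ r G := by
  have hn₀' : n₀ ≠ 0 := by omega
  have hL' : L ≠ 0 := by omega
  obtain ⟨φ⟩ : Nonempty (GaloisField p n₀ →ₐ[ZMod p] GaloisField p L) :=
    FiniteField.nonempty_algHom_of_finrank_dvd
      (by rwa [GaloisField.finrank p hn₀', GaloisField.finrank p hL'])
  let := φ.toRingHom.toAlgebra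
  have : IsScalarTower (ZMod p) (GaloisField p n₀) (GaloisField p L) :=
    IsScalarTower.of_algebraMap_eq fun x => (φ.commutes x).symm
  let := Fintype.ofFinite (GaloisField p n₀)
  have hcard : Fintype.card (GaloisField p n₀) = p ^ n₀ := by
    rw [← Nat.card_eq_fintype_card, GaloisField.card p n₀ hn₀']
  have hrank := Module.finrank_mul_finrank (ZMod p) (GaloisField p n₀) (GaloisField p L)
  rw [GaloisField.finrank p hn₀', GaloisField.finrank p hL'] at hrank
  refine exists_pmdsCond_of_finrank (F := GaloisField p n₀) ?_ (fun i => ?_) ?_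
  · have h := hn₀ ⟨0, by omega⟩
    have h' := hr ⟨0, by omega⟩
    omega
  · have h := hn₀ i
    omega
  · refine Nat.le_of_mul_le_mul_left ?_ hn₀pos
    rwa [hrank, ← mul_assoc]
end

section
/- Let F be a field, and fix integers m ≥ 2, ℓ ≥ 1, s ≥ 1, r_1,…,r_m ≥ 1 with k = mℓ − s ≥ ℓ and n = Σ_{i=1}^m (ℓ + r_i). Suppose G ∈ F^{k×n} satisfies the PMDS condition. Then there exists an invertible matrix P ∈ GL_k(F) such that P·G = (B_1 | … | B_m), where for each i the block B_i = (C_i | D_i) with C_i ∈ F^{k×ℓ} and D_i ∈ F^{k×r_i}, and the k×(mℓ) matrix G_C = (C_1 | … | C_m) obtained by concatenating the C_i has the form G_C = [I_k | A], where I_k is the k×k identity matrix and A ∈ F^{k×s} is superregular, i.e., every square submatrix of A (of any size) is invertible. -/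
/-- The position, among the `m*ℓ` "local" columns `C_1 | … | C_m` (listed block after
block), of the `t`-th local column of the `i`-th block. -/
def colIdx {m ℓ : ℕ} (i : Fin m) (t : Fin ℓ) : Fin (m * ℓ) :=
  ⟨i.1 * ℓ + t.1, by
    calc i.1 * ℓ + t.1 < i.1 * ℓ + ℓ := by have := t.isLt; omega
      _ = (i.1 + 1) * ℓ := by ring
      _ ≤ m * ℓ := Nat.mul_le_mul_right ℓ i.isLt⟩

/-- Entry `a` of column `colIdx i t` of the `k × (m*ℓ)` matrix `[I_k | A]`,
where `k + s = m * ℓ` and `A ∈ F^{k×s}`. -/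
def stdEntry {F : Type*} [Field F] {m ℓ s k : ℕ} (hk : k + s = m * ℓ)
    (A : Matrix (Fin k) (Fin s) F) (a : Fin k) (i : Fin m) (t : Fin ℓ) : F :=
  if hq : (colIdx i t).1 < k then (if a.1 = (colIdx i t).1 then 1 else 0)
  else A a ⟨(colIdx i t).1 - k, by
    have h1 : (colIdx i t).1 < k + s := lt_of_lt_of_le (colIdx i t).isLt (le_of_eq hk.symm)
    omega⟩

/-- A matrix is superregular if every square submatrix (of any size, with rows and
columns chosen injectively) is invertible. -/
def Superregular {F : Type*} [Field F] {k s : ℕ} (A : Matrix (Fin k) (Fin s) F) : Prop :=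
  ∀ (z : ℕ) (ri : Fin z → Fin k) (ci : Fin z → Fin s),
    Function.Injective ri → Function.Injective ci →
    IsUnit (Matrix.det (Matrix.of fun a b => A (ri a) (ci b)))

/-- If every maximal square submatrix of `[1 | A]` is invertible, then `A` is superregular. -/
theorem superregular_of_isUnit_det_fromCols_one {F : Type*} [Field F] {k s : ℕ}
    (A : Matrix (Fin k) (Fin s) F)
    (h : ∀ f : Fin k → Fin k ⊕ Fin s, Function.Injective f →
      IsUnit ((Matrix.fromCols 1 A).submatrix id f).det) :
    Superregular A := by
  intro z ri ci hri hci
  rw [isUnit_iff_ne_zero]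
  intro hdet
  obtain ⟨v, hv, hvA⟩ := Matrix.exists_vecMul_eq_zero_iff.2 hdet
  let f : Fin k → Fin k ⊕ Fin s := Function.extend ri (Sum.inr ∘ ci) Sum.inl
  have f_range (j) : f (ri j) = Sum.inr (ci j) := hri.extend_apply _ _ j
  have f_compl (b) (hb : ¬ ∃ j, ri j = b) : f b = Sum.inl b := Function.extend_apply' _ _ b hb
  have f_inj : Function.Injective f := by
    intro b c hbc
    by_cases hb : ∃ j, ri j = b <;> by_cases hc : ∃ j, ri j = c
    · obtain ⟨i, rfl⟩ := hb
      obtain ⟨j, rfl⟩ := hc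
      rw [f_range, f_range] at hbc
      rw [hci (Sum.inr_injective hbc)]
    · obtain ⟨i, rfl⟩ := hb
      simp [f_range, f_compl c hc] at hbc
    · obtain ⟨j, rfl⟩ := hc
      simp [f_range, f_compl b hb] at hbc
    · rw [f_compl b hb, f_compl c hc] at hbc
      exact Sum.inl_injective hbc
  let x : Fin k → F := Function.extend ri v 0
  have x_range (j) : x (ri j) = v j := hri.extend_apply _ _ j
  have x_compl (b) (hb : ¬ ∃ j, ri j = b) : x b = 0 := Function.extend_apply' _ _ b hb
  refine (h f f_inj).ne_zero (Matrix.exists_vecMul_eq_zero_iff.1 ⟨x, ?_, ?_⟩)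
  · intro hx0
    apply hv
    ext j
    rw [← x_range, hx0, Pi.zero_apply, Pi.zero_apply]
  · ext b
    by_cases hb : ∃ j, ri j = b
    · obtain ⟨j, rfl⟩ := hb
      refine Eq.trans (Eq.symm ?_) (congrFun hvA j)
      refine Fintype.sum_of_injective ri hri _ _ (fun a ha => ?_) fun i => ?_
      · simp [x_compl a ha]
      · simp [x_range, f_range]
    · simp [Matrix.vecMul, dotProduct, f_compl b hb, Matrix.one_apply, x_compl b hb]

/-- The position in the blocked index type of the `q`-th local column. -/
def localCol {m ℓ : ℕ} (r : Fin m → ℕ) (q : Fin (m * ℓ)) : (i : Fin m) × Fin (ℓ + r i) :=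
  ⟨(finProdFinEquiv.symm q).1, Fin.castAdd _ (finProdFinEquiv.symm q).2⟩

theorem localCol_colIdx {m ℓ : ℕ} (r : Fin m → ℕ) (i : Fin m) (t : Fin ℓ) :
    localCol r (colIdx i t) = ⟨i, Fin.castAdd (r i) t⟩ := by
  have h : colIdx i t = finProdFinEquiv (i, t) := by
    ext
    simp [colIdx, finProdFinEquiv, add_comm, mul_comm]
  rw [h, localCol, Equiv.symm_apply_apply]

theorem localCol_injective {m ℓ : ℕ} (r : Fin m → ℕ) :
    Function.Injective (localCol (ℓ := ℓ) r) := by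
  intro p q h
  exact finProdFinEquiv.symm.injective
    (Prod.ext (congrArg Sigma.fst h) (Fin.ext (congrArg (fun x => x.2.val) h)))

theorem PMDSCond.isUnit_det_localCol {F : Type*} [Field F] {k m ℓ : ℕ} {r : Fin m → ℕ}
    {G : Matrix (Fin k) ((i : Fin m) × Fin (ℓ + r i)) F} (hG : PMDSCond F ℓ r G)
    {f : Fin k → Fin (m * ℓ)} (hf : Function.Injective f) :
    IsUnit (G.submatrix id (localCol r ∘ f)).det := by
  refine hG (localCol r ∘ f) ((localCol_injective r).comp hf) fun i => ?_
  refine le_of_le_of_eq (Finset.card_le_card_of_injOn (fun b => (finProdFinEquiv.symm (f b)).2)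
    (fun _ _ => Finset.mem_univ _) fun b hb c hc h => ?_) (Finset.card_fin ℓ)
  simp only [Finset.coe_filter, Finset.mem_univ, true_and, Set.mem_ofPred_eq] at hb hc
  exact hf (finProdFinEquiv.symm.injective (Prod.ext (hb.trans hc.symm) h))

/-- **PMDS standard form.** If `G` satisfies the PMDS condition then there is
an invertible matrix `P ∈ GL_k(F)` such that in `P * G` the first `ℓ` columns `C_i` of each
block concatenate (in block order) to a matrix `G_C = [I_k | A]` with `A` superregular. -/
theorem pmds_standard_form (F : Type*) [Field F] (m ℓ s k : ℕ) (r : Fin m → ℕ)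
    (hm : 2 ≤ m) (hℓ : 1 ≤ ℓ) (hs : 1 ≤ s) (hr : ∀ i, 1 ≤ r i)
    (hk : k + s = m * ℓ) (hℓk : ℓ ≤ k)
    (G : Matrix (Fin k) ((i : Fin m) × Fin (ℓ + r i)) F)
    (hG : PMDSCond F ℓ r G) :
    ∃ P : Matrix (Fin k) (Fin k) F, IsUnit P.det ∧
      ∃ A : Matrix (Fin k) (Fin s) F, Superregular A ∧
        ∀ (a : Fin k) (i : Fin m) (t : Fin ℓ),
          (P * G) a ⟨i, Fin.castAdd (r i) t⟩ = stdEntry hk A a i t := by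
  let g : Fin k ⊕ Fin s ≃ Fin (m * ℓ) := finSumFinEquiv.trans (finCongr hk)
  let M : Matrix (Fin k) (Fin k ⊕ Fin s) F := G.submatrix id (localCol r ∘ g)
  have hM {f : Fin k → Fin k ⊕ Fin s} (hf : Function.Injective f) :
      IsUnit (M.submatrix id f).det :=
    hG.isUnit_det_localCol (g.injective.comp hf)
  have hdet : IsUnit M.toCols₁.det := hM Sum.inl_injective
  have hP : IsUnit (M.toCols₁⁻¹).det := Matrix.isUnit_nonsing_inv_det _ hdet
  have hPM : M.toCols₁⁻¹ * M = Matrix.fromCols 1 (M.toCols₁⁻¹ * M.toCols₂) := by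
    conv_lhs => rw [← Matrix.fromCols_toCols M]
    rw [Matrix.toCols₁_fromCols, Matrix.mul_fromCols, Matrix.nonsing_inv_mul _ hdet]
  refine ⟨M.toCols₁⁻¹, hP, M.toCols₁⁻¹ * M.toCols₂, ?_, fun a i t => ?_⟩
  · refine superregular_of_isUnit_det_fromCols_one _ fun f hf => ?_
    rw [← hPM]
    have : (M.toCols₁⁻¹ * M).submatrix id f = M.toCols₁⁻¹ * M.submatrix id f := rfl
    rw [this, Matrix.det_mul]
    exact hP.mul (hM hf)
  · obtain ⟨y, hy⟩ := g.surjective (colIdx i t)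
    have h := congrFun (congrFun hPM a) y
    have hcol : (M.toCols₁⁻¹ * M) a y = (M.toCols₁⁻¹ * G) a (localCol r (g y)) := rfl
    rw [hcol, hy, localCol_colIdx] at h
    rw [h]
    have hv : (colIdx i t).1 = (finSumFinEquiv y).1 := by rw [← hy]; rfl
    rcases y with b | c
    · simp [stdEntry, hv, Matrix.one_apply, Fin.ext_iff]
    · simp [stdEntry, hv]
end

section
/- Let F be a field, let σ be a finite type of variables, and let k ≤ n be positive integers. Let M be a k×n matrix with entries in the multivariate polynomial ring F[x_σ] such that all entries in some fixed set of k columns are constants (total degree 0) and every entry of M has total degree at most 2. Then the sum, over all k-element subsets S of the column index set, of the total degree of det(M_S) — where M_S is the k×k submatrix of M formed by the columns in S — is at most 2(n − k) · binom(n − 1, k − 1). In particular, the product over all k-element column subsets S of det(M_S) has total degree at most 2(n − k) · binom(n − 1, k − 1). -/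
/-- The determinant of the `k × k` submatrix of `M` formed by the columns in a
`k`-element set `S` (via some enumeration of `S`; determinants for different
enumerations agree up to sign). -/
noncomputable def subDet {R : Type*} [CommRing R] {k : ℕ} {ι : Type*}
    (M : Matrix (Fin k) ι R) (S : Finset ι) (hS : S.card = k) : R :=
  Matrix.det (Matrix.of fun a b => M a ((S.equivFinOfCardEq hS).symm b).1)

open Finset in
theorem card_filter_mem_powersetCard_univ {n k : ℕ} (hk : 1 ≤ k) (j : Fin n) :
    #{S ∈ powersetCard k (univ : Finset (Fin n)) | j ∈ S} = (n - 1).choose (k - 1) := by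
  simpa using card_filter_powersetCard_subset {j} univ k (subset_univ _) (by simpa using hk)

open Finset in
theorem sum_card_sdiff_powersetCard_univ {n k : ℕ} (hk : 1 ≤ k) (T : Finset (Fin n)) :
    ∑ S ∈ powersetCard k (univ : Finset (Fin n)), #(S \ T) =
      (n - #T) * (n - 1).choose (k - 1) := by
  have h (S : Finset (Fin n)) : #(S \ T) = ∑ j ∈ Tᶜ, if j ∈ S then 1 else 0 := by
    rw [← card_filter]
    congr 1
    ext j
    simp [and_comm]
  simp_rw [h]
  rw [sum_comm]
  simp_rw [← card_filter, card_filter_mem_powersetCard_univ hk]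
  simp [card_compl]

/-- A determinant has total degree at most the sum of degree bounds for its columns. -/
theorem MvPolynomial.totalDegree_det_le_sum {R σ ι : Type*} [CommRing R] [Fintype ι]
    [DecidableEq ι] (A : Matrix ι ι (MvPolynomial σ R)) (d : ι → ℕ)
    (h : ∀ i j, (A i j).totalDegree ≤ d j) : A.det.totalDegree ≤ ∑ j, d j := by
  rw [Matrix.det_apply]
  refine MvPolynomial.totalDegree_finsetSum_le fun τ _ => ?_
  have hp : (∏ i, A (τ i) i).totalDegree ≤ ∑ j, d j :=
    (MvPolynomial.totalDegree_finsetProd _ _).trans (Finset.sum_le_sum fun i _ => h _ _)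
  rcases Int.units_eq_one_or (Equiv.Perm.sign τ) with hs | hs <;> simpa [hs] using hp

theorem totalDegree_subDet_le {R σ ι : Type*} [CommRing R] [DecidableEq ι] {k c : ℕ}
    (M : Matrix (Fin k) ι (MvPolynomial σ R)) (T : Finset ι)
    (hconst : ∀ a, ∀ j ∈ T, (M a j).totalDegree = 0)
    (hdeg : ∀ a j, (M a j).totalDegree ≤ c) (S : Finset ι) (hS : S.card = k) :
    (subDet M S hS).totalDegree ≤ c * (S \ T).card := by
  refine (MvPolynomial.totalDegree_det_le_sum _
    (fun b => if ((S.equivFinOfCardEq hS).symm b).1 ∈ T then 0 else c) fun a b => ?_).trans ?_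
  · simp only [Matrix.of_apply]
    split_ifs with hb
    · exact (hconst _ _ hb).le
    · exact hdeg _ _
  · rw [Equiv.sum_comp (S.equivFinOfCardEq hS).symm (fun j => if j.1 ∈ T then 0 else c),
      Finset.sum_coe_sort S (fun j => if j ∈ T then 0 else c), Finset.sum_ite,
      Finset.sum_const_zero, zero_add, Finset.sum_const, smul_eq_mul, mul_comm,
      Finset.sdiff_eq_filter]

/-- Let `M` be a `k × n` matrix (`1 ≤ k ≤ n`) over a multivariate
polynomial ring whose entries in some fixed set `T` of `k` columns are constants
(total degree `0`) and all of whose entries have total degree at most `2`. Then the sum,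
over all `k`-element column subsets `S`, of the total degrees of `det M_S` is at most
`2(n − k)·C(n−1, k−1)`; in particular the product of all these determinants has total
degree at most `2(n − k)·C(n−1, k−1)`. -/
theorem det_degree_sum_bound (F : Type*) [Field F] (σ : Type*) [Fintype σ]
    (k n : ℕ) (hk : 1 ≤ k) (hkn : k ≤ n)
    (M : Matrix (Fin k) (Fin n) (MvPolynomial σ F))
    (T : Finset (Fin n)) (hT : T.card = k)
    (hconst : ∀ (a : Fin k), ∀ j ∈ T, (M a j).totalDegree = 0)
    (hdeg : ∀ (a : Fin k) (j : Fin n), (M a j).totalDegree ≤ 2) :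
    (∑ S ∈ (Finset.powersetCard k (Finset.univ : Finset (Fin n))).attach,
        (subDet M S.1 (Finset.mem_powersetCard.mp S.2).2).totalDegree)
      ≤ 2 * (n - k) * Nat.choose (n - 1) (k - 1) ∧
    (∏ S ∈ (Finset.powersetCard k (Finset.univ : Finset (Fin n))).attach,
        subDet M S.1 (Finset.mem_powersetCard.mp S.2).2).totalDegree
      ≤ 2 * (n - k) * Nat.choose (n - 1) (k - 1) := by
  have hsum : (∑ S ∈ (Finset.powersetCard k (Finset.univ : Finset (Fin n))).attach,
      (subDet M S.1 (Finset.mem_powersetCard.mp S.2).2).totalDegree)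
        ≤ 2 * (n - k) * Nat.choose (n - 1) (k - 1) := by
    refine (Finset.sum_le_sum fun S _ => totalDegree_subDet_le M T hconst hdeg S.1 _).trans ?_
    rw [Finset.sum_attach _ (fun S => 2 * (S \ T).card), ← Finset.mul_sum,
      sum_card_sdiff_powersetCard_univ hk, hT, mul_assoc]
  exact ⟨hsum, (MvPolynomial.totalDegree_finsetProd _ _).trans hsum⟩
end

section
/- Fix integers m ≥ 2, ℓ ≥ 1, s ≥ 1 and r_1,…,r_m ≥ 1 with k = mℓ − s ≥ ℓ and n = Σ_{i=1}^m (ℓ + r_i). Set M* = M(k−1; ℓ+r_1,…,ℓ+r_{m−1}, ℓ+r_m−1; ℓ,…,ℓ,ℓ−1). If F is a finite field with |F| > M*, then there exists a matrix G ∈ F^{k×n} satisfying the PMDS condition; i.e., there exists an [n, k, ℓ; r_1,…,r_m]-PMDS code over F. -/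
/-- `Mcount k nb f` is the number of `k`-element subsets `I` of the disjoint union of
blocks `J_1, …, J_m` (block `i` having `nb i` elements) with `|I ∩ J_i| ≤ f i` for
every `i`. This is the quantity `M(k; n_1, …, n_m; f_1, …, f_m)`. -/
def Mcount (k : ℕ) {m : ℕ} (nb f : Fin m → ℕ) : ℕ :=
  ((Finset.powersetCard k (Finset.univ : Finset ((i : Fin m) × Fin (nb i)))).filter
    (fun I => ∀ i : Fin m, (I.filter (fun c => c.1 = i)).card ≤ f i)).card

/-- Fewer than `|F|` proper subspaces do not cover a finite-dimensional vector space over a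
finite field `F`. -/
theorem exists_forall_notMem_of_card_lt {F V ι : Type*} [Field F] [Fintype F] [AddCommGroup V]
    [Module F V] [FiniteDimensional F V] (s : Finset ι) (U : ι → Submodule F V)
    (hs : s.card < Fintype.card F)
    (hU : ∀ i ∈ s, Module.finrank F (U i) < Module.finrank F V) :
    ∃ w : V, ∀ i ∈ s, w ∉ U i := by
  classical
  have : Finite V := Module.finite_of_finite F
  have := Fintype.ofFinite V
  by_contra! hcover
  have hq : 0 < Fintype.card F := Fintype.card_pos
  have hsub : (Finset.univ : Finset V) ⊆
      s.biUnion fun i => Finset.univ.filter fun w => w ∈ U i := by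
    intro w _
    simpa using hcover w
  have hle : Fintype.card V ≤ s.card * Fintype.card F ^ (Module.finrank F V - 1) := by
    refine (Finset.card_le_card hsub).trans (Finset.card_biUnion_le_card_mul _ _ _ ?_)
    intro i hi
    rw [← Fintype.card_subtype]
    have hUi := Module.card_eq_pow_finrank (K := F) (V := U i)
    refine le_of_eq_of_le hUi (Nat.pow_le_pow_right hq ?_)
    have := hU i hi
    omega
  obtain ⟨i, hi, -⟩ := hcover 0
  have hpos := hU i hi
  obtain ⟨d, hd⟩ : ∃ d, Module.finrank F V = d + 1 := ⟨Module.finrank F V - 1, by omega⟩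
  rw [Module.card_eq_pow_finrank (K := F) (V := V), hd, Nat.add_sub_cancel, pow_succ'] at hle
  exact absurd (Nat.le_of_mul_le_mul_right hle (pow_pos hq d)) (not_le.mpr hs)

/-- In a disjoint union of blocks, a set respecting block capacities `f i ≤ nb i` extends to
one of any prescribed size between its own and the total capacity. -/
theorem exists_superset_card_eq_of_block_card_le {m : ℕ} {nb f : Fin m → ℕ}
    (hf : ∀ i, f i ≤ nb i) {N : ℕ} (hN : N ≤ ∑ i, f i)
    (A : Finset ((i : Fin m) × Fin (nb i))) (hA : A.card ≤ N)
    (hAf : ∀ i, (A.filter fun c => c.1 = i).card ≤ f i) :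
    ∃ I, A ⊆ I ∧ I.card = N ∧ ∀ i, (I.filter fun c => c.1 = i).card ≤ f i := by
  classical
  induction hd : N - A.card generalizing A with
  | zero => exact ⟨A, subset_rfl, by omega, hAf⟩
  | succ d ih =>
    have hsum : A.card = ∑ i, (A.filter fun c => c.1 = i).card :=
      Finset.card_eq_sum_card_fiberwise (by simp)
    obtain ⟨i, hi⟩ : ∃ i, (A.filter fun c => c.1 = i).card < f i := by
      by_contra! h
      have := Finset.sum_le_sum fun i (_ : i ∈ Finset.univ) => h i
      omega
    obtain ⟨x, hx⟩ : ∃ x : Fin (nb i), (⟨i, x⟩ : (i : Fin m) × Fin (nb i)) ∉ A := by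
      by_contra! h
      have hsub : Finset.univ.image (Sigma.mk (β := fun i => Fin (nb i)) i) ⊆
          A.filter fun c => c.1 = i := by
        intro c hc
        obtain ⟨x, -, rfl⟩ := Finset.mem_image.mp hc
        simpa using h x
      have := Finset.card_le_card hsub
      rw [Finset.card_image_of_injective _ sigma_mk_injective, Finset.card_fin] at this
      have := hf i
      omega
    have hcard := Finset.card_insert_of_notMem hx
    obtain ⟨I, hAI, hI⟩ := ih (insert ⟨i, x⟩ A) (by omega) (fun j => by
      rw [Finset.filter_insert]
      split_ifs with hij
      · dsimp only at hij
        subst hij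
        exact (Finset.card_insert_le _ _).trans hi
      · exact hAf j) (by omega)
    exact ⟨I, (Finset.subset_insert _ _).trans hAI, hI⟩

/-- Set
`M* = M(k−1; ℓ+r_1, …, ℓ+r_{m−1}, ℓ+r_m−1; ℓ, …, ℓ, ℓ−1)`. If `F` is a finite field
with `|F| > M*`, then there exists an `[n, k, ℓ; r_1, …, r_m]`-PMDS code over `F`. -/
theorem pmds_exists_of_card_gt_Mstar (F : Type*) [Field F] [Fintype F]
    (m ℓ s k : ℕ) (r : Fin m → ℕ)
    (hm : 2 ≤ m) (hℓ : 1 ≤ ℓ) (hs : 1 ≤ s) (hr : ∀ i, 1 ≤ r i)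
    (hk : k + s = m * ℓ) (hℓk : ℓ ≤ k)
    (hcard : Mcount (k - 1)
        (fun i => if i.1 = m - 1 then ℓ + r i - 1 else ℓ + r i)
        (fun i => if i.1 = m - 1 then ℓ - 1 else ℓ) < Fintype.card F) :
    ∃ G : Matrix (Fin k) ((i : Fin m) × Fin (ℓ + r i)) F, PMDSCond F ℓ r G := by
  classical
  set nb : Fin m → ℕ := fun i => if i.1 = m - 1 then ℓ + r i - 1 else ℓ + r i with hnb
  set f : Fin m → ℕ := fun i => if i.1 = m - 1 then ℓ - 1 else ℓ with hf
  have hnb_le : ∀ i, nb i ≤ ℓ + r i := fun i => by simp only [hnb]; split_ifs <;> omega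
  have hf_le : ∀ i, f i ≤ nb i := fun i => by simp only [hnb, hf]; split_ifs <;> omega
  have hf_sum : k - 1 ≤ ∑ i, f i := by
    have h : ∑ i, (f i + if i = (⟨m - 1, by omega⟩ : Fin m) then 1 else 0) = ∑ _i : Fin m, ℓ := by
      refine Finset.sum_congr rfl fun i _ => ?_
      simp only [hf, Fin.ext_iff]
      split_ifs <;> omega
    rw [Finset.sum_add_distrib, Finset.sum_ite_eq' Finset.univ, if_pos (Finset.mem_univ _),
      Finset.sum_const, Finset.card_fin, smul_eq_mul] at h
    omega
  let g : (i : Fin m) × Fin (nb i) → (i : Fin m) × Fin (ℓ + r i) :=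
    fun c => ⟨c.1, Fin.castLE (hnb_le c.1) c.2⟩
  have hg : Function.Injective g := by
    rintro ⟨i, x⟩ ⟨j, y⟩ h
    simp only [g, Sigma.mk.injEq] at h
    obtain ⟨rfl, h⟩ := h
    simpa using h
  have greedy : ∀ T : Finset ((i : Fin m) × Fin (ℓ + r i)),
      ∃ v : (i : Fin m) × Fin (ℓ + r i) → Fin k → F, ∀ A ⊆ T, A.card ≤ k →
        (∀ i, (A.filter fun c => c.1 = i).card ≤ ℓ) → LinearIndepOn F v (A : Set _) := by
    intro T
    induction T using Finset.induction_on_max_value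
        (fun c : (i : Fin m) × Fin (ℓ + r i) => toLex (c.1.1, c.2.1)) with
    | empty =>
      refine ⟨0, fun A hA _ _ => ?_⟩
      rw [Finset.subset_empty.mp hA, Finset.coe_empty]
      exact linearIndepOn_empty F _
    | insert a T haT hmax ih =>
      obtain ⟨v, hv⟩ := ih
      obtain ⟨w, hw⟩ := exists_forall_notMem_of_card_lt (F := F) _
        (fun I : Finset ((i : Fin m) × Fin (nb i)) =>
          Submodule.span F ((I.image (v ∘ g) : Finset (Fin k → F)) : Set (Fin k → F))) hcard
        (fun I hI => by
          have hIcard := (Finset.mem_powersetCard.mp (Finset.mem_filter.mp hI).1).2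
          have h₁ : Module.finrank F (Submodule.span F
              ((I.image (v ∘ g) : Finset (Fin k → F)) : Set (Fin k → F))) ≤ _ :=
            finrank_span_finset_le_card (R := F) (I.image (v ∘ g))
          have h₂ : (I.image (v ∘ g)).card ≤ I.card := Finset.card_image_le
          rw [Module.finrank_fin_fun]
          omega)
      have hle : ∀ c ∈ T, c.1.1 < a.1.1 ∨ c.1.1 = a.1.1 ∧ c.2.1 ≤ a.2.1 := fun c hc =>
        Prod.Lex.toLex_le_toLex.mp (hmax c hc)
      have hT : ∀ c ∈ T, ∃ c', g c' = c := by
        intro c hc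
        have hlt : c.2.1 < nb c.1 := by
          have hc2 := c.2.2
          simp only [hnb]
          split_ifs with hlast
          · have ha1 := a.1.2
            rcases hle c hc with h | ⟨h₁, h₂⟩
            · omega
            · obtain ⟨i, x⟩ := c
              obtain ⟨j, y⟩ := a
              obtain rfl : i = j := Fin.ext h₁
              have hne : x.1 ≠ y.1 := fun h => haT (by rwa [Fin.ext h] at hc)
              have hy := y.2
              dsimp only at *
              omega
          · exact hc2
        exact ⟨⟨c.1, ⟨c.2.1, hlt⟩⟩, rfl⟩
      refine ⟨Function.update v a w, fun A hA hAk hAℓ => ?_⟩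
      by_cases haA : a ∈ A
      swap
      · have hAT : A ⊆ T := (Finset.subset_insert_iff_of_notMem haA).mp hA
        refine (hv A hAT hAk hAℓ).congr fun c hc => ?_
        exact (Function.update_of_ne (ne_of_mem_of_not_mem hc haA) _ _).symm
      obtain ⟨B, haB, rfl⟩ : ∃ B, a ∉ B ∧ insert a B = A :=
        ⟨A.erase a, Finset.notMem_erase _ _, Finset.insert_erase haA⟩
      have hBT : B ⊆ T := fun c hc => Finset.mem_of_mem_insert_of_ne
        (hA (Finset.mem_insert_of_mem hc)) (ne_of_mem_of_not_mem hc haB)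
      have hBℓ : ∀ i, (B.filter fun c => c.1 = i).card ≤ ℓ := fun i =>
        (Finset.card_le_card (Finset.filter_subset_filter _ (Finset.subset_insert a B))).trans
          (hAℓ i)
      have hBf : ∀ i, (B.filter fun c => c.1 = i).card ≤ f i := by
        intro i
        simp only [hf]
        split_ifs with hlast
        · by_cases hai : a.1 = i
          · have h := hAℓ i
            rw [Finset.filter_insert, if_pos hai, Finset.card_insert_of_notMem
              (fun h => haB (Finset.mem_filter.mp h).1)] at h
            omega
          · rw [Finset.filter_eq_empty_iff.mpr, Finset.card_empty]
            · exact Nat.zero_le _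
            rintro c hc rfl
            have ha1 := a.1.2
            rcases hle c (hBT hc) with h | h
            · omega
            · exact hai (Fin.ext h.1.symm)
        · exact hBℓ i
      have hBk : B.card + 1 ≤ k := by rwa [Finset.card_insert_of_notMem haB] at hAk
      let B' := Finset.univ.filter fun c => g c ∈ B
      have hBimage : B'.image g = B := by
        ext c
        simp only [B', Finset.mem_image, Finset.mem_filter, Finset.mem_univ, true_and]
        constructor
        · rintro ⟨c', hc', rfl⟩
          exact hc'
        · intro hc
          obtain ⟨c', rfl⟩ := hT c (hBT hc)
          exact ⟨c', hc, rfl⟩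
      obtain ⟨I, hBI, hIk, hIf⟩ := exists_superset_card_eq_of_block_card_le hf_le hf_sum B'
        (by rw [← Finset.card_image_of_injective B' hg, hBimage]; omega)
        (fun i => by
          refine le_trans ?_ (hBf i)
          refine Finset.card_le_card_of_injOn g (fun c hc => ?_) hg.injOn
          simpa [B', g] using hc)
      rw [Finset.coe_insert, linearIndepOn_insert (by simpa using haB)]
      have hcongr : Set.EqOn v (Function.update v a w) (B : Set _) := fun c hc =>
        (Function.update_of_ne (ne_of_mem_of_not_mem hc haB) _ _).symm
      refine ⟨(hv B hBT (by omega) hBℓ).congr hcongr, ?_⟩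
      rw [Function.update_self, ← Set.image_congr hcongr]
      refine fun hmem => hw I ?_ (Submodule.span_mono ?_ hmem)
      · exact Finset.mem_filter.mpr
          ⟨Finset.mem_powersetCard.mpr ⟨Finset.subset_univ _, hIk⟩, hIf⟩
      · rw [← hBimage, Finset.coe_image, Finset.coe_image, Set.image_comp]
        exact Set.image_mono (Set.image_mono (Finset.coe_subset.mpr hBI))
  obtain ⟨v, hv⟩ := greedy Finset.univ
  refine ⟨Matrix.of fun a c => v c a, fun e he hblock => ?_⟩
  have hindep := hv (Finset.univ.image e) (Finset.subset_univ _)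
    (Finset.card_image_le.trans (by simp)) (fun i => by
      rw [Finset.filter_image]
      exact Finset.card_image_le.trans (hblock i))
  rw [Finset.coe_image, Finset.coe_univ, Set.image_univ, linearIndepOn_range_iff he] at hindep
  rw [← Matrix.isUnit_iff_isUnit_det, ← Matrix.linearIndependent_cols_iff_isUnit]
  exact hindep
end

section
/- Let F ⊆ K be a field extension, let n ≥ 1, and let C ⊆ K^n be a K-linear subspace with dim_K C = k, where 1 ≤ k ≤ n. Then there exists a nonzero codeword c ∈ C whose rank is at most n − k + 1, where the rank of a vector v ∈ K^n is defined as dim_F span_F{v_1,…,v_n}, the dimension over F of the F-linear span of its coordinates. Equivalently, the minimum rank distance of the K-linear rank-metric code C satisfies d_R(C) ≤ n − k + 1 (Singleton-like bound). -/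
/-- A subspace of `K^n` of dimension greater than `m ≤ n` contains a nonzero vector whose first
`m` coordinates vanish. -/
theorem Submodule.exists_mem_ne_zero_of_lt_finrank {K : Type*} [Field K] {m n : ℕ} (hmn : m ≤ n)
    (C : Submodule K (Fin n → K)) (hC : m < Module.finrank K C) :
    ∃ c ∈ C, c ≠ 0 ∧ ∀ i : Fin n, (i : ℕ) < m → c i = 0 := by
  let f : C →ₗ[K] (Fin m → K) := (LinearMap.funLeft K K (Fin.castLE hmn)).comp C.subtype
  have hf : LinearMap.ker f ≠ ⊥ := LinearMap.ker_ne_bot_of_finrank_lt (by simpa using hC)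
  obtain ⟨x, hx, hx0⟩ := Submodule.exists_mem_ne_zero_of_ne_bot hf
  exact ⟨x, x.2, by simpa using hx0, fun i hi ↦ congrFun (LinearMap.mem_ker.mp hx) ⟨i, hi⟩⟩

/-- The span of the entries of a vector in `K^n` whose first `m` coordinates vanish has dimension
at most `n - m`. -/
theorem finrank_span_range_le_of_eq_zero (F : Type*) {K : Type*} [Field F] [AddCommGroup K]
    [Module F K] {m n : ℕ} (c : Fin n → K) (hc : ∀ i : Fin n, (i : ℕ) < m → c i = 0) :
    Module.finrank F (Submodule.span F (Set.range c)) ≤ n - m := by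
  let g : Fin (n - m) → K := fun j ↦ c ⟨j + m, by omega⟩
  have hle : Submodule.span F (Set.range c) ≤ Submodule.span F (Set.range g) := by
    rw [Submodule.span_le]
    rintro _ ⟨i, rfl⟩
    by_cases hi : (i : ℕ) < m
    · simp [hc i hi]
    · refine Submodule.subset_span ⟨⟨i - m, by omega⟩, congrArg c (Fin.ext ?_)⟩
      simp only
      omega
  have : FiniteDimensional F (Submodule.span F (Set.range g)) :=
    FiniteDimensional.span_of_finite F (Set.finite_range g)
  calc _ ≤ Module.finrank F (Submodule.span F (Set.range g)) := Submodule.finrank_mono hle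
    _ ≤ n - m := by simpa [Set.finrank] using finrank_range_le_card (R := F) g

/-- **Singleton-like bound for the rank metric.** Let `F ⊆ K` be a field
extension and `C ⊆ K^n` a `K`-linear subspace of dimension `k` with `1 ≤ k ≤ n`. Then
there exists a nonzero codeword `c ∈ C` whose rank — the `F`-dimension of the `F`-span
of its coordinates — is at most `n − k + 1`. -/
theorem rank_metric_singleton_bound (F K : Type*) [Field F] [Field K] [Algebra F K]
    (n k : ℕ) (hk : 1 ≤ k) (hkn : k ≤ n)
    (C : Submodule K (Fin n → K)) (hC : Module.finrank K C = k) :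
    ∃ c ∈ C, c ≠ 0 ∧
      Module.finrank F (Submodule.span F (Set.range c)) ≤ n - k + 1 := by
  obtain ⟨c, hcC, hc0, hc⟩ :=
    C.exists_mem_ne_zero_of_lt_finrank (m := k - 1) (by omega) (by omega)
  exact ⟨c, hcC, hc0, (finrank_span_range_le_of_eq_zero F c hc).trans (by omega)⟩
end

section
/- Let F be a finite field and K a finite field extension of F of degree N, with φ : F → K the inclusion. Let 1 ≤ k ≤ n ≤ N and let G ∈ K^{k×n} be a matrix of rank k, generating the K-linear code C = {uG : u ∈ K^k} ⊆ K^n. Then the following are equivalent: (a) C is a maximum rank distance (MRD) code, i.e., every nonzero codeword c ∈ C has rank at least n − k + 1, where the rank of c is dim_F span_F{c_1,…,c_n}; (b) for every matrix E ∈ F^{k×n} of rank k over F, the k×k matrix G · φ(E)^T is invertible over K. -/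
open Module in
/-- The `F`-rank of `c` is complementary to the dimension of its space of `F`-linear relations. -/
lemma finrank_span_range_add_finrank_ker {F V ι : Type*} [Field F] [AddCommGroup V] [Module F V]
    [Fintype ι] (c : ι → V) :
    finrank F (Submodule.span F (Set.range c))
      + finrank F (LinearMap.ker (Fintype.linearCombination F c)) = Fintype.card ι := by
  have h := (Fintype.linearCombination F c).finrank_range_add_finrank_ker
  rwa [Fintype.range_linearCombination, finrank_fintype_fun_eq_card] at h

/-- A matrix has rank equal to its number of rows iff its rows are linearly independent. -/
lemma Matrix.rank_eq_card_height_iff {F m n : Type*} [Field F] [Fintype m] [Fintype n]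
    (A : Matrix m n F) : A.rank = Fintype.card m ↔ LinearIndependent F A.row := by
  rw [linearIndependent_iff_card_eq_finrank_span, A.rank_eq_finrank_span_row, eq_comm]
  rfl

/-- `u G φ(E)ᵀ` evaluates, on the rows of `E`, the relation map of the codeword `u G`. -/
lemma Matrix.vecMul_mul_map_transpose_apply {F K k m n : Type*} [Field F] [Field K] [Algebra F K]
    [Fintype k] [Fintype n] (u : k → K) (G : Matrix k n K) (E : Matrix m n F) (i : m) :
    Matrix.vecMul u (G * (E.map (algebraMap F K)).transpose) i
      = Fintype.linearCombination F (Matrix.vecMul u G) (E i) := by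
  rw [← Matrix.vecMul_vecMul, Fintype.linearCombination_apply]
  simp [Matrix.vecMul, dotProduct, Algebra.smul_def, mul_comm]


/-- **MRD criterion.** Let `F` be a finite field and `K/F` an extension
of degree `N`, `1 ≤ k ≤ n ≤ N`, and let `G ∈ K^{k×n}` have rank `k`, generating the code
`C = {uG : u ∈ K^k}`. Then `C` is MRD — every nonzero codeword `uG` has rank
(`= dim_F span_F` of its coordinates) at least `n − k + 1` — if and only if for every
`E ∈ F^{k×n}` of rank `k` the matrix `G ⬝ φ(E)ᵀ` is invertible over `K`, where
`φ : F → K` is the inclusion. -/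
theorem mrd_criterion (F K : Type*) [Field F] [Fintype F] [Field K] [Algebra F K]
    (N n k : ℕ) (hN : Module.finrank F K = N)
    (hk : 1 ≤ k) (hkn : k ≤ n) (hnN : n ≤ N)
    (G : Matrix (Fin k) (Fin n) K) (hG : G.rank = k) :
    (∀ u : Fin k → K, Matrix.vecMul u G ≠ 0 →
        n - k + 1 ≤ Module.finrank F (Submodule.span F (Set.range (Matrix.vecMul u G))))
      ↔ (∀ E : Matrix (Fin k) (Fin n) F, E.rank = k →
        IsUnit ((G * (E.map (algebraMap F K)).transpose).det)) := by
  have rank_iff (E : Matrix (Fin k) (Fin n) F) : E.rank = k ↔ LinearIndependent F E.row := by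
    simpa using E.rank_eq_card_height_iff
  have hGrow : LinearIndependent K G.row := by
    rw [← G.rank_eq_card_height_iff, hG, Fintype.card_fin]
  constructor
  · intro h E hE
    by_contra hdet
    rw [isUnit_iff_ne_zero, not_not, ← Matrix.exists_vecMul_eq_zero_iff] at hdet
    obtain ⟨u, hu, hM⟩ := hdet
    have hc : Matrix.vecMul u G ≠ 0 := fun h0 =>
      hu (Matrix.vecMul_injective_iff.2 hGrow (by simpa using h0))
    have hker (i : Fin k) :
        E i ∈ LinearMap.ker (Fintype.linearCombination F (Matrix.vecMul u G)) := by
      rw [LinearMap.mem_ker, ← Matrix.vecMul_mul_map_transpose_apply, hM, Pi.zero_apply]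
    have hle := (Submodule.finrank_mono (Submodule.span_le.2 (Set.range_subset_iff.2 hker)))
    have hspan := finrank_span_eq_card ((rank_iff E).1 hE)
    have hsum := finrank_span_range_add_finrank_ker (F := F) (Matrix.vecMul u G)
    have hr := h u hc
    simp only [Fintype.card_fin] at hspan hsum
    change Module.finrank F (Submodule.span F (Set.range E)) = k at hspan
    omega
  · intro h u hc
    by_contra hr
    have hsum := finrank_span_range_add_finrank_ker (F := F) (Matrix.vecMul u G)
    rw [Fintype.card_fin] at hsum
    obtain ⟨f, hf⟩ := exists_linearIndependent_of_le_finrank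
      (show k ≤ Module.finrank F
        (LinearMap.ker (Fintype.linearCombination F (Matrix.vecMul u G))) by omega)
    let E : Matrix (Fin k) (Fin n) F := Matrix.of fun i => (f i : Fin n → F)
    have hE : E.rank = k := (rank_iff E).2 (hf.map' (Submodule.subtype _) (Submodule.ker_subtype _))
    refine (h E hE).ne_zero (Matrix.exists_vecMul_eq_zero_iff.1 ⟨u, ?_, ?_⟩)
    · rintro rfl
      exact hc (Matrix.zero_vecMul G)
    · ext i
      rw [Matrix.vecMul_mul_map_transpose_apply]
      exact (f i).2
end

section
/- Fix integers m ≥ 2 and ℓ, r_1,…,r_m ≥ 1, let s = 1, k = mℓ − 1 (assume k ≥ ℓ), and n = Σ_{i=1}^m (ℓ + r_i). If F is a finite field with |F| ≥ max_i r_i + ℓ, then there exists a matrix G ∈ F^{k×n} satisfying the PMDS condition; i.e., there exists an [n, k = mℓ − 1, ℓ; r_1,…,r_m]-PMDS code over F. -/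
open Polynomial in
/-- A polynomial of degree `< d` vanishing at the injective images of at least `d` points
is zero. -/
theorem Polynomial.eq_zero_of_degree_lt_card_of_injOn {F ι : Type*} [Field F] {d : ℕ} {p : F[X]}
    (s : Finset ι) {x : ι → F} (hx : Set.InjOn x s) (hp : p.degree < d) (hd : d ≤ s.card)
    (hs : ∀ b ∈ s, p.eval (x b) = 0) : p = 0 :=
  Polynomial.eq_zero_of_degree_lt_of_eval_index_eq_zero s hx
    (hp.trans_le (by exact_mod_cast hd)) hs

/-- If `m` numbers are at most `ℓ` and sum to `m * ℓ - 1`, all but one of them equal `ℓ`,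
and the remaining one is `ℓ - 1`. -/
theorem exists_eq_pred_and_eq_of_sum_add_one {m ℓ : ℕ} (f : Fin m → ℕ) (hf : ∀ i, f i ≤ ℓ)
    (hsum : (∑ i, f i) + 1 = m * ℓ) :
    ∃ i, f i + 1 = ℓ ∧ ∀ j, j ≠ i → f j = ℓ := by
  have h : ∑ i, (ℓ - f i) = 1 := by
    have : ∑ i, (ℓ - f i) + ∑ i, f i = m * ℓ := by
      rw [← Finset.sum_add_distrib]
      simp [fun i => Nat.sub_add_cancel (hf i)]
    omega
  obtain ⟨i, -, hi⟩ := Finset.exists_ne_zero_of_sum_ne_zero (h.trans_ne one_ne_zero)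
  rw [← Finset.add_sum_erase _ _ (Finset.mem_univ i)] at h
  have h0 : ∑ j ∈ Finset.univ.erase i, (ℓ - f j) = 0 := by omega
  rw [Finset.sum_eq_zero_iff] at h0
  refine ⟨i, by omega, fun j hj => ?_⟩
  have := h0 j (by simp [hj])
  have := hf j
  omega

open Polynomial in
/-- Tuples of `m` polynomials of degree `< ℓ` are mapped to the sum of their coefficients of
`X ^ (ℓ - 1)`. -/
noncomputable def sumTopCoeff (F : Type*) [Field F] (m ℓ : ℕ) :
    (Fin m → degreeLT F ℓ) →ₗ[F] F :=
  ∑ i, lcoeff F (ℓ - 1) ∘ₗ (degreeLT F ℓ).subtype ∘ₗ LinearMap.proj i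

open Polynomial in
theorem sumTopCoeff_apply (F : Type*) [Field F] (m ℓ : ℕ) (p : Fin m → degreeLT F ℓ) :
    sumTopCoeff F m ℓ p = ∑ i, (p i : F[X]).coeff (ℓ - 1) := by
  simp [sumTopCoeff]

theorem le_finrank_ker_sumTopCoeff (F : Type*) [Field F] {m ℓ k : ℕ} (hk : k + 1 = m * ℓ) :
    k ≤ Module.finrank F (LinearMap.ker (sumTopCoeff F m ℓ)) := by
  have : Module.Finite F (Polynomial.degreeLT F ℓ) :=
    Module.Finite.equiv (Polynomial.degreeLTEquiv F ℓ).symm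
  have h := LinearMap.finrank_range_add_finrank_ker (sumTopCoeff F m ℓ)
  have h1 := Submodule.finrank_le (LinearMap.range (sumTopCoeff F m ℓ))
  rw [Module.finrank_self] at h1
  rw [Module.finrank_pi_fintype, (Polynomial.degreeLTEquiv F ℓ).finrank_eq] at h
  simp only [Module.finrank_fin_fun, Finset.sum_const, Finset.card_univ, Fintype.card_fin,
    smul_eq_mul] at h
  omega

theorem LinearMap.exists_linearIndependent_apply_eq_zero_of_le_finrank_ker {F V W : Type*}
    [Field F] [AddCommGroup V] [Module F V] [AddCommGroup W] [Module F W] (f : V →ₗ[F] W) {k : ℕ}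
    (hk : k ≤ Module.finrank F (LinearMap.ker f)) :
    ∃ w : Fin k → V, LinearIndependent F w ∧ ∀ a, f (w a) = 0 := by
  obtain ⟨w, hw⟩ := exists_linearIndependent_of_le_finrank hk
  exact ⟨fun a => (w a).1, hw.map' (Submodule.subtype _) (Submodule.ker_subtype _),
    fun a => (w a).2⟩

open Polynomial in
/-- A tuple of polynomials of degree `< ℓ` whose coefficients of `X ^ (ℓ - 1)` sum to zero
vanishes as soon as it has `m * ℓ - 1` zeros in total, at most `ℓ` per component. -/
theorem eq_zero_of_mem_ker_sumTopCoeff {F : Type*} [Field F] {m ℓ k : ℕ} {r : Fin m → ℕ}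
    (hk : k + 1 = m * ℓ) (x : ∀ i, Fin (ℓ + r i) ↪ F)
    (e : Fin k → (i : Fin m) × Fin (ℓ + r i)) (he : Function.Injective e)
    (hcard : ∀ i : Fin m, (Finset.univ.filter (fun b => (e b).1 = i)).card ≤ ℓ)
    {p : Fin m → degreeLT F ℓ} (hp : sumTopCoeff F m ℓ p = 0)
    (hzero : ∀ b, (p (e b).1 : F[X]).eval (x (e b).1 (e b).2) = 0) : p = 0 := by
  have hsum : (∑ i, (Finset.univ.filter (fun b => (e b).1 = i)).card) + 1 = m * ℓ := by
    rw [← Finset.card_eq_sum_card_fiberwise (by simp), Finset.card_univ, Fintype.card_fin, hk]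
  obtain ⟨i, hi, hne⟩ := exists_eq_pred_and_eq_of_sum_add_one _ hcard hsum
  have key : ∀ (j : Fin m) (d : ℕ), (p j : F[X]).degree < d →
      d ≤ (Finset.univ.filter (fun b => (e b).1 = j)).card → p j = 0 := by
    intro j d hdeg hd
    refine Subtype.ext (eq_zero_of_degree_lt_card_of_injOn _
      (x := fun b => x (e b).1 (e b).2) ?_ hdeg hd ?_)
    · intro a ha b hb hab
      simp only [Finset.coe_filter, Finset.mem_univ, true_and, Set.mem_ofPred_eq] at ha hb
      replace hab : x (e a).1 (e a).2 = x (e b).1 (e b).2 := hab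
      apply he
      generalize e a = u at *
      generalize e b = v at *
      obtain ⟨u, u'⟩ := u
      obtain ⟨v, v'⟩ := v
      obtain rfl : u = j := ha
      obtain rfl : v = u := hb
      exact congrArg _ ((x v).injective hab)
    · intro b hb
      obtain rfl := (Finset.mem_filter.mp hb).2
      exact hzero b
  have hj : ∀ j, j ≠ i → p j = 0 := fun j hji =>
    key j ℓ (mem_degreeLT.mp (p j).2) (hne j hji).ge
  have hcoeff : (p i : F[X]).coeff (ℓ - 1) = 0 := by
    rwa [sumTopCoeff_apply, Finset.sum_eq_single i (fun j _ hji => by simp [hj j hji])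
      (by simp)] at hp
  have hpi : p i = 0 := by
    refine key i (ℓ - 1) ?_ (by omega)
    rw [degree_lt_iff_coeff_zero]
    intro n hn
    rcases hn.eq_or_lt with rfl | hlt
    · exact hcoeff
    · exact (degree_lt_iff_coeff_zero _ _).mp (mem_degreeLT.mp (p i).2) n (by omega)
  funext j
  by_cases h : j = i
  · rw [h, hpi, Pi.zero_apply]
  · exact hj j h

/-- For `s = 1` (so `k = mℓ − 1`): if `F` is a finite field with
`|F| ≥ max_i r_i + ℓ`, then there exists an `[n, k = mℓ − 1, ℓ; r_1, …, r_m]`-PMDS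
code over `F`. -/
theorem pmds_exists_s_eq_one (F : Type*) [Field F] [Fintype F]
    (m ℓ k : ℕ) (r : Fin m → ℕ)
    (hm : 2 ≤ m) (hℓ : 1 ≤ ℓ) (hr : ∀ i, 1 ≤ r i)
    (hk : k + 1 = m * ℓ) (hℓk : ℓ ≤ k)
    (hcard : Finset.univ.sup r + ℓ ≤ Fintype.card F) :
    ∃ G : Matrix (Fin k) ((i : Fin m) × Fin (ℓ + r i)) F, PMDSCond F ℓ r G := by
  have hemb : ∀ i, Nonempty (Fin (ℓ + r i) ↪ F) := fun i => by
    apply Function.Embedding.nonempty_of_card_le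
    have := Finset.le_sup (f := r) (Finset.mem_univ i)
    rw [Fintype.card_fin]
    omega
  let x : ∀ i, Fin (ℓ + r i) ↪ F := fun i => (hemb i).some
  obtain ⟨w, hw, hw0⟩ :=
    (sumTopCoeff F m ℓ).exists_linearIndependent_apply_eq_zero_of_le_finrank_ker
      (le_finrank_ker_sumTopCoeff F hk)
  refine ⟨fun a c => (w a c.1 : Polynomial F).eval (x c.1 c.2), fun e he hle => ?_⟩
  rw [isUnit_iff_ne_zero]
  intro hdet
  obtain ⟨c, hc, hmul⟩ := Matrix.exists_vecMul_eq_zero_iff.mpr hdet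
  have hzero : ∑ a, c a • w a = 0 := by
    refine eq_zero_of_mem_ker_sumTopCoeff hk x e he hle (by simp [hw0]) fun b => ?_
    have := congrFun hmul b
    simpa [Matrix.vecMul, dotProduct, Polynomial.eval_finsetSum] using this
  exact hc (funext (Fintype.linearIndependent_iff.mp hw c hzero))
end
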